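/- arXiv:1602.03610 — 5 statements merged into one kernel-verified Lean document; each statement's English description precedes it below -/
import Mathlib

section
/- Let n ≥ 2 be a natural number and let p, K be real numbers with p > 2 and K > 0. Define A = 2p(p−1)^(p−1)/(n−1), and for ε > 0 define B(ε) = (2/p)·(p(n−1))^(p/2)·K^p·ε^(−(p−2)/2) and C(ε) = (p/(n−1) − ((p−2)/p)·ε)·p·(p−1)^(2(p−1))/(n−1). Then for ε₃ = p³/((n−1)(p−1)²) one has C(ε₃) > 0 and B(ε₃)/(A + 2√(C(ε₃))) = ((n−1)K/p)^p. -/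
/-- Evaluation of the eigenvalue bound `B(ε)/(A + 2√(C(ε)))` at the optimal
`ε₃ = p³/((n−1)(p−1)²)` gives `((n−1)K/p)^p`, for `p > 2`. -/
theorem eigenvalue_bound_at_optimal_eps (n : ℕ) (hn : 2 ≤ n) (p K : ℝ)
    (hp : 2 < p) (hK : 0 < K) :
    let A : ℝ := 2 * p * (p - 1) ^ (p - 1) / ((n : ℝ) - 1)
    let B : ℝ → ℝ := fun ε =>
      2 / p * (p * ((n : ℝ) - 1)) ^ (p / 2) * K ^ p * ε ^ (-(p - 2) / 2)
    let C : ℝ → ℝ := fun ε =>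
      (p / ((n : ℝ) - 1) - (p - 2) / p * ε) * p * (p - 1) ^ (2 * (p - 1)) / ((n : ℝ) - 1)
    let ε₃ : ℝ := p ^ 3 / (((n : ℝ) - 1) * (p - 1) ^ 2)
    0 < C ε₃ ∧ B ε₃ / (A + 2 * Real.sqrt (C ε₃)) = (((n : ℝ) - 1) * K / p) ^ p := by
  intro A B C ε₃
  have hm : (0 : ℝ) < (n : ℝ) - 1 := by
    have : (2 : ℝ) ≤ n := by exact_mod_cast hn
    linarith
  have hp0 : 0 < p := by linarith
  have hq : 0 < p - 1 := by linarith
  have hC : C ε₃ = (p * (p - 1) ^ (p - 1) / (((n : ℝ) - 1) * (p - 1))) ^ 2 := by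
    have h2 : (p - 1) ^ (2 * (p - 1)) = ((p - 1) ^ (p - 1)) ^ 2 := by
      rw [← Real.rpow_natCast, ← Real.rpow_mul hq.le]
      congr 1
      push_cast
      ring
    simp only [C, ε₃, h2]
    field_simp
    ring
  have hD : A + 2 * Real.sqrt (C ε₃) =
      2 * p ^ 2 * (p - 1) ^ (p - 1) / (((n : ℝ) - 1) * (p - 1)) := by
    rw [hC, Real.sqrt_sq (by positivity)]
    simp only [A]
    generalize (p - 1) ^ (p - 1) = y
    field_simp
    ring
  refine ⟨by rw [hC]; positivity, ?_⟩
  rw [hD]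
  simp only [B, ε₃]
  generalize (n : ℝ) - 1 = m at hm ⊢
  refine Real.log_injOn_pos (Set.mem_Ioi.2 (by positivity)) (Set.mem_Ioi.2 (by positivity)) ?_
  rw [Real.log_div (by positivity) (by positivity), Real.log_mul (by positivity) (by positivity),
    Real.log_mul (by positivity) (by positivity), Real.log_mul (by positivity) (by positivity),
    Real.log_div (by positivity) (by positivity), Real.log_div (by positivity) (by positivity),
    Real.log_mul (by positivity) (by positivity), Real.log_mul (by positivity) (by positivity),
    Real.log_rpow (by positivity), Real.log_rpow (by positivity), Real.log_rpow (by positivity),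
    Real.log_rpow (by positivity), Real.log_rpow (by positivity),
    Real.log_div (by positivity) (by positivity), Real.log_div (by positivity) (by positivity),
    Real.log_mul hp0.ne' hm.ne', Real.log_mul hm.ne' (pow_pos hq 2).ne',
    Real.log_mul hm.ne' hq.ne', Real.log_mul hm.ne' hK.ne',
    Real.log_pow, Real.log_pow, Real.log_pow]
  push_cast
  ring
end

section
/- Let n ≥ 2 be a natural number and let p, K be real numbers with p > 2 and K > 0. Define A = 2p(p−1)^(p−1)/(n−1), and for ε > 0 define B(ε) = (2/p)·(p(n−1))^(p/2)·K^p·ε^(−(p−2)/2) and C(ε) = (p/(n−1) − ((p−2)/p)·ε)·p·(p−1)^(2(p−1))/(n−1). Then for every ε with 0 < ε < p²/((n−1)(p−2)) one has B(ε)/(A + 2√(C(ε))) ≥ ((n−1)K/p)^p. -/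
/-- Weighted AM-GM for `(1 + s) / p` and `(1 - s) / (p - 2)`, with weights proportional to
`p` and `p - 2`, in logarithmic form. -/
lemma weighted_log_amgm {p s : ℝ} (hp : 2 < p) (hs0 : 0 ≤ s) (hs1 : s < 1) :
    p / 2 * (Real.log (1 + s) - Real.log p)
      + (p - 2) / 2 * (Real.log (1 - s) - Real.log (p - 2))
      + (p - 1) * Real.log (p - 1) ≤ 0 := by
  have hp0 : 0 < p := by linarith
  have hp1 : 0 < p - 1 := by linarith
  have hp2 : 0 < p - 2 := by linarith
  have ha : 0 < 1 + s := by linarith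
  have hb : 0 < 1 - s := by linarith
  have h₁ := Real.log_le_sub_one_of_pos (show 0 < (p - 1) * (1 + s) / p by positivity)
  have h₂ := Real.log_le_sub_one_of_pos (show 0 < (p - 1) * (1 - s) / (p - 2) by positivity)
  rw [Real.log_div (by positivity) hp0.ne', Real.log_mul hp1.ne' ha.ne'] at h₁
  rw [Real.log_div (by positivity) hp2.ne', Real.log_mul hp1.ne' hb.ne'] at h₂
  have h₃ := mul_le_mul_of_nonneg_left h₁ (show 0 ≤ p / 2 by positivity)
  have h₄ := mul_le_mul_of_nonneg_left h₂ (show 0 ≤ (p - 2) / 2 by positivity)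
  have h₅ : p / 2 * ((p - 1) * (1 + s) / p - 1)
      + (p - 2) / 2 * ((p - 1) * (1 - s) / (p - 2) - 1) = 0 := by
    field_simp
    ring
  linarith

/-- For `p > 2` and every admissible `ε`, the bound `B(ε)/(A + 2√(C(ε)))` is at
least its minimum `((n−1)K/p)^p`. -/
theorem eigenvalue_bound_minimized (n : ℕ) (hn : 2 ≤ n) (p K : ℝ)
    (hp : 2 < p) (hK : 0 < K) :
    let A : ℝ := 2 * p * (p - 1) ^ (p - 1) / ((n : ℝ) - 1)
    let B : ℝ → ℝ := fun ε =>
      2 / p * (p * ((n : ℝ) - 1)) ^ (p / 2) * K ^ p * ε ^ (-(p - 2) / 2)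
    let C : ℝ → ℝ := fun ε =>
      (p / ((n : ℝ) - 1) - (p - 2) / p * ε) * p * (p - 1) ^ (2 * (p - 1)) / ((n : ℝ) - 1)
    ∀ ε : ℝ, 0 < ε → ε < p ^ 2 / (((n : ℝ) - 1) * (p - 2)) →
      B ε / (A + 2 * Real.sqrt (C ε)) ≥ (((n : ℝ) - 1) * K / p) ^ p := by
  intro A B C ε hε hε'
  have hn' : (2 : ℝ) ≤ n := by exact_mod_cast hn
  have hp0 : 0 < p := by linarith
  have hp1 : 0 < p - 1 := by linarith
  have hp2 : 0 < p - 2 := by linarith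
  simp only [A, B, C]
  obtain ⟨m, hm⟩ : ∃ m : ℝ, m = (n : ℝ) - 1 := ⟨_, rfl⟩
  rw [← hm] at hε' ⊢
  have hm0 : 0 < m := by linarith
  rw [lt_div_iff₀ (by positivity)] at hε'
  have hx0 : 0 < (p - 2) * m * ε / p ^ 2 := by positivity
  have hx1 : (p - 2) * m * ε / p ^ 2 < 1 := by
    rw [div_lt_one (by positivity)]
    linarith
  obtain ⟨s, hs⟩ : ∃ s, s = √(1 - (p - 2) * m * ε / p ^ 2) := ⟨_, rfl⟩
  have hs0 : 0 ≤ s := hs ▸ Real.sqrt_nonneg _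
  have hss : s ^ 2 = 1 - (p - 2) * m * ε / p ^ 2 := by
    rw [hs, Real.sq_sqrt (by linarith)]
  have hs1 : s < 1 := by nlinarith
  have ha : 0 < 1 + s := by linarith
  have hb : 0 < 1 - s := by linarith
  have hεs : ε = (1 + s) * (1 - s) * p ^ 2 / ((p - 2) * m) := by
    have : (1 + s) * (1 - s) = (p - 2) * m * ε / p ^ 2 := by linear_combination -hss
    rw [this]
    field_simp
  have hQ : 0 < (p - 1) ^ (p - 1) := Real.rpow_pos_of_pos hp1 _
  have hC : √((p / m - (p - 2) / p * ε) * p * (p - 1) ^ (2 * (p - 1)) / m)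
      = p / m * (p - 1) ^ (p - 1) * s := by
    have hsq : (p / m - (p - 2) / p * ε) * p * (p - 1) ^ (2 * (p - 1)) / m
        = (p / m * (p - 1) ^ (p - 1) * s) ^ 2 := by
      rw [two_mul (p - 1), Real.rpow_add hp1, mul_pow, hss]
      field_simp
    rw [hsq, Real.sqrt_sq (by positivity)]
  have hD : 2 * p * (p - 1) ^ (p - 1) / m + 2 * (p / m * (p - 1) ^ (p - 1) * s)
      = 2 * p * (p - 1) ^ (p - 1) * (1 + s) / m := by ring
  rw [hC, hD, ge_iff_le, ← Real.log_le_log_iff (by positivity) (by positivity)]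
  have hlogε : Real.log ε = Real.log (1 + s) + Real.log (1 - s) + 2 * Real.log p
      - (Real.log (p - 2) + Real.log m) := by
    rw [hεs, Real.log_div (by positivity) (by positivity), Real.log_mul (by positivity)
      (by positivity), Real.log_mul ha.ne' hb.ne', Real.log_pow, Real.log_mul hp2.ne' hm0.ne']
    norm_num
  have hL : Real.log ((m * K / p) ^ p) = p * (Real.log m + Real.log K - Real.log p) := by
    rw [Real.log_rpow (by positivity), Real.log_div (by positivity) hp0.ne',
      Real.log_mul hm0.ne' hK.ne']
  have hN : Real.log (2 / p * (p * m) ^ (p / 2) * K ^ p * ε ^ (-(p - 2) / 2))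
      = Real.log 2 - Real.log p + p / 2 * (Real.log p + Real.log m) + p * Real.log K
        + -(p - 2) / 2 * Real.log ε := by
    rw [Real.log_mul (by positivity) (by positivity), Real.log_mul (by positivity) (by positivity),
      Real.log_mul (by positivity) (by positivity), Real.log_div (by positivity) (by positivity),
      Real.log_rpow (by positivity), Real.log_rpow hK, Real.log_rpow hε,
      Real.log_mul hp0.ne' hm0.ne']
  have hM : Real.log (2 * p * (p - 1) ^ (p - 1) * (1 + s) / m)
      = Real.log 2 + Real.log p + (p - 1) * Real.log (p - 1) + Real.log (1 + s) - Real.log m := by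
    rw [Real.log_div (by positivity) (by positivity), Real.log_mul (by positivity) (by positivity),
      Real.log_mul (by positivity) (by positivity), Real.log_mul (by positivity) (by positivity),
      Real.log_rpow hp1]
  rw [Real.log_div (by positivity) (by positivity), hL, hN, hM, hlogε]
  linear_combination weighted_log_amgm hp hs0 hs1
end

section
/- Let n ≥ 2 be a natural number and let p, K be real numbers with p > 2 and K > 0. Define A = 2p(p−1)^(p−1)/(n−1), and for ε > 0 define B(ε) = (2/p)·(p(n−1))^(p/2)·K^p·ε^(−(p−2)/2) and C(ε) = (p/(n−1) − ((p−2)/p)·ε)·p·(p−1)^(2(p−1))/(n−1). If λ ≥ 0 is a real number such that (A² − 4C(ε))·λ² − 2A·B(ε)·λ + B(ε)² ≥ 0 for every ε with 0 < ε < p²/((n−1)(p−2)), then λ ≤ ((n−1)K/p)^p. -/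
/-- The value of the coefficient `B` at the critical parameter `ε = p³/((p-1)²m)`. -/
lemma coeff_at_critical_parameter {p m K : ℝ} (hp : 2 < p) (hm : 0 < m) (hK : 0 < K) :
    2 / p * (p * m) ^ (p / 2) * K ^ p * (p ^ 3 / ((p - 1) ^ 2 * m)) ^ (-(p - 2) / 2) =
      (m * K / p) ^ p * (2 * p * (p - 1) ^ (p - 1) / m) * (p / (p - 1)) := by
  have h0 : 0 < p := by linarith
  have h1 : 0 < p - 1 := by linarith
  apply Real.log_injOn_pos (Set.mem_Ioi.2 (by positivity)) (Set.mem_Ioi.2 (by positivity))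
  have e1 : Real.log (p ^ 3 / ((p - 1) ^ 2 * m)) =
      3 * Real.log p - (2 * Real.log (p - 1) + Real.log m) := by
    rw [Real.log_div (by positivity) (by positivity), Real.log_mul (by positivity) (by positivity),
      Real.log_pow, Real.log_pow]
    norm_num
  have e2 : Real.log (m * K / p) = Real.log m + Real.log K - Real.log p := by
    rw [Real.log_div (by positivity) (by positivity), Real.log_mul (by positivity) (by positivity)]
  rw [Real.log_mul (by positivity) (by positivity), Real.log_mul (by positivity) (by positivity),
    Real.log_mul (by positivity) (by positivity), Real.log_mul (by positivity) (by positivity),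
    Real.log_mul (by positivity) (by positivity), Real.log_div (by positivity) (by positivity),
    Real.log_div (by positivity) (by positivity), Real.log_div (by positivity) (by positivity),
    Real.log_mul (by positivity) (by positivity), Real.log_mul (by positivity) (by positivity),
    Real.log_rpow (by positivity), Real.log_rpow (by positivity), Real.log_rpow (by positivity),
    Real.log_rpow (by positivity), Real.log_rpow (by positivity), e1, e2,
    Real.log_mul (by positivity) (by positivity)]
  ring

/-- A decreasing power `b ε^(-q)` attains every value `y` above its value at `δ`
at some point of `(0, δ)`. -/
lemma exists_lt_mul_rpow_neg_eq {b q y δ : ℝ} (hb : 0 < b) (hq : 0 < q) (hδ : 0 < δ)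
    (hy : b * δ ^ (-q) < y) : ∃ ε, 0 < ε ∧ ε < δ ∧ b * ε ^ (-q) = y := by
  have hy0 : 0 < y := lt_trans (by positivity) hy
  have hval : b * ((y / b) ^ (-q)⁻¹) ^ (-q) = y := by
    rw [Real.rpow_inv_rpow (by positivity) (by linarith)]
    field_simp
  have hpos : 0 < (y / b) ^ (-q)⁻¹ := by positivity
  refine ⟨_, hpos, ?_, hval⟩
  rw [← hval] at hy
  exact (Real.rpow_lt_rpow_iff_of_neg hδ hpos (by linarith)).1 (lt_of_mul_lt_mul_left hy hb.le)

/-- Analytic core of Theorem 1.1: if `λ ≥ 0` satisfies the quadratic inequality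
`(A² − 4C(ε))λ² − 2AB(ε)λ + B(ε)² ≥ 0` for every admissible `ε`, then
`λ ≤ ((n−1)K/p)^p`. -/
theorem eigenvalue_upper_bound_p_gt_two (n : ℕ) (hn : 2 ≤ n) (p K lam : ℝ)
    (hp : 2 < p) (hK : 0 < K) (hlam : 0 ≤ lam) :
    let A : ℝ := 2 * p * (p - 1) ^ (p - 1) / ((n : ℝ) - 1)
    let B : ℝ → ℝ := fun ε =>
      2 / p * (p * ((n : ℝ) - 1)) ^ (p / 2) * K ^ p * ε ^ (-(p - 2) / 2)
    let C : ℝ → ℝ := fun ε =>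
      (p / ((n : ℝ) - 1) - (p - 2) / p * ε) * p * (p - 1) ^ (2 * (p - 1)) / ((n : ℝ) - 1)
    (∀ ε : ℝ, 0 < ε → ε < p ^ 2 / (((n : ℝ) - 1) * (p - 2)) →
        (A ^ 2 - 4 * C ε) * lam ^ 2 - 2 * A * B ε * lam + B ε ^ 2 ≥ 0) →
      lam ≤ (((n : ℝ) - 1) * K / p) ^ p := by
  have hn' : (2 : ℝ) ≤ n := by exact_mod_cast hn
  obtain ⟨m, hm⟩ : ∃ m : ℝ, m = (n : ℝ) - 1 := ⟨_, rfl⟩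
  rw [← hm]
  intro A B C h
  have hm0 : 0 < m := by linarith
  have h0 : 0 < p := by linarith
  have h1 : 0 < p - 1 := by linarith
  have h2 : 0 < p - 2 := by linarith
  by_contra! hlt
  have hlam0 : 0 < lam := lt_trans (by positivity) hlt
  have hA : 0 < A := by positivity
  set δ : ℝ := p ^ 3 / ((p - 1) ^ 2 * m) with hδ
  have hδ0 : 0 < δ := by positivity
  have hδ1 : δ < p ^ 2 / (m * (p - 2)) := by
    rw [hδ, div_lt_div_iff₀ (by positivity) (by positivity)]
    have : 0 < p ^ 2 * m := by positivity
    nlinarith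
  have hsq : (p - 1) ^ (2 * (p - 1)) = ((p - 1) ^ (p - 1)) ^ 2 := by
    rw [mul_comm, Real.rpow_mul h1.le, Real.rpow_two]
  have hCδ : 4 * C δ = (A / (p - 1)) ^ 2 := by
    simp only [A, C, hsq, hδ]
    field_simp
    ring
  have hBδ : B δ = (m * K / p) ^ p * A * (p / (p - 1)) := coeff_at_critical_parameter hp hm0 hK
  have hBlt : B δ < lam * A + lam * (A / (p - 1)) := by
    have e : lam * A + lam * (A / (p - 1)) = lam * A * (p / (p - 1)) := by
      field_simp
      ring
    rw [hBδ, e]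
    gcongr
  have hs : 0 < lam * (A / (p - 1)) := by positivity
  have hBA : B δ < A * lam := by
    have hq := h δ hδ0 hδ1
    rw [hCδ] at hq
    by_contra! hle
    nlinarith
  obtain ⟨ε, hε0, hεδ, hε⟩ : ∃ ε, 0 < ε ∧ ε < δ ∧ B ε = A * lam := by
    have e : -(p - 2) / 2 = -((p - 2) / 2) := by ring
    simp only [B, e] at hBA ⊢
    exact exists_lt_mul_rpow_neg_eq (by positivity) (by positivity) hδ0 hBA
  have hC : 0 < C ε := by
    have : 0 < p / m - (p - 2) / p * ε := by
      have hε1 := hεδ.trans hδ1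
      rw [lt_div_iff₀ (by positivity)] at hε1
      rw [sub_pos, div_mul_eq_mul_div, div_lt_div_iff₀ h0 hm0]
      nlinarith
    positivity
  have hq := h ε hε0 (hεδ.trans hδ1)
  rw [hε] at hq
  have : 0 < C ε * lam ^ 2 := by positivity
  nlinarith
end

section
/- Let n ≥ 2 be a natural number and let p, K be real numbers with 1 < p < 2 and K > 0. Define Ã = 2p(p−1)^(p−1)/(n−1), and for ε > 0 define B̃(ε) = (2(p−1)/p)·(p(n−1)K²)^(p/(2(p−1)))·ε^(−1) and D̃(ε) = ((2−p)/(n−1))·ε^(2(p−1)/(2−p)). Then for every ε > 0 one has (B̃(ε)² + 4D̃(ε))/(2·Ã·B̃(ε)) ≥ ((n−1)K/p)^p. -/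
/-- For `1 < p < 2` and every `ε > 0`, the bound `(B̃(ε)² + 4D̃(ε))/(2ÃB̃(ε))`
is at least its minimum `((n−1)K/p)^p`. -/
theorem eigenvalue_bound_minimized_p_lt_two (n : ℕ) (hn : 2 ≤ n) (p K : ℝ)
    (hp1 : 1 < p) (hp2 : p < 2) (hK : 0 < K) :
    let At : ℝ := 2 * p * (p - 1) ^ (p - 1) / ((n : ℝ) - 1)
    let Bt : ℝ → ℝ := fun ε =>
      2 * (p - 1) / p * (p * ((n : ℝ) - 1) * K ^ 2) ^ (p / (2 * (p - 1))) * ε⁻¹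
    let Dt : ℝ → ℝ := fun ε =>
      (2 - p) / ((n : ℝ) - 1) * ε ^ (2 * (p - 1) / (2 - p))
    ∀ ε : ℝ, 0 < ε →
      (Bt ε ^ 2 + 4 * Dt ε) / (2 * At * Bt ε) ≥ (((n : ℝ) - 1) * K / p) ^ p := by
  intro At Bt Dt ε hε
  have hm : (0 : ℝ) < (n : ℝ) - 1 := by
    have : (2 : ℝ) ≤ n := by exact_mod_cast hn
    linarith
  have hp : 0 < p := by linarith
  have hq : 0 < p - 1 := by linarith
  have hr : 0 < 2 - p := by linarith
  have hAdef : At = 2 * p * (p - 1) ^ (p - 1) / ((n : ℝ) - 1) := rfl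
  have hBdef : Bt ε =
      2 * (p - 1) / p * (p * ((n : ℝ) - 1) * K ^ 2) ^ (p / (2 * (p - 1))) * ε⁻¹ := rfl
  have hDdef : Dt ε = (2 - p) / ((n : ℝ) - 1) * ε ^ (2 * (p - 1) / (2 - p)) := rfl
  clear_value At Bt Dt
  generalize (n : ℝ) - 1 = m at *
  have hA : 0 < At := by rw [hAdef]; positivity
  have hB : 0 < Bt ε := by rw [hBdef]; positivity
  have hE : 0 < ε ^ (2 * (p - 1) / (2 - p)) := by positivity
  have logA : Real.log At =
      Real.log 2 + Real.log p + (p - 1) * Real.log (p - 1) - Real.log m := by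
    rw [hAdef, Real.log_div (by positivity) hm.ne', Real.log_mul (by positivity) (by positivity),
      Real.log_mul two_ne_zero hp.ne', Real.log_rpow hq]
  have logB : Real.log (Bt ε) = Real.log 2 + Real.log (p - 1) - Real.log p +
      p / (2 * (p - 1)) * (Real.log p + Real.log m + 2 * Real.log K) - Real.log ε := by
    rw [hBdef, Real.log_mul (by positivity) (by positivity),
      Real.log_mul (by positivity) (by positivity), Real.log_div (by positivity) hp.ne',
      Real.log_mul two_ne_zero hq.ne', Real.log_rpow (by positivity),
      Real.log_mul (by positivity) (by positivity), Real.log_mul hp.ne' hm.ne', Real.log_pow,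
      Real.log_inv]
    push_cast
    ring
  have amgm := Real.geom_mean_le_arith_mean2_weighted
    (w₁ := p / 2) (w₂ := (2 - p) / 2)
    (p₁ := Bt ε / (p * At)) (p₂ := 2 ^ 2 * ε ^ (2 * (p - 1) / (2 - p)) / (m * At * Bt ε))
    (by positivity) (by positivity) (by positivity) (by positivity) (by ring)
  have sum_eq : (Bt ε ^ 2 + 4 * Dt ε) / (2 * At * Bt ε) = p / 2 * (Bt ε / (p * At)) +
      (2 - p) / 2 * (2 ^ 2 * ε ^ (2 * (p - 1) / (2 - p)) / (m * At * Bt ε)) := by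
    rw [hDdef]
    field_simp
    ring
  rw [ge_iff_le, sum_eq]
  refine le_of_eq_of_le ?_ amgm
  apply Real.log_injOn_pos (Set.mem_Ioi.2 (by positivity)) (Set.mem_Ioi.2 (by positivity))
  rw [Real.log_rpow (by positivity), Real.log_div (by positivity) hp.ne',
    Real.log_mul hm.ne' hK.ne', Real.log_mul (by positivity) (by positivity),
    Real.log_rpow (by positivity), Real.log_rpow (by positivity),
    Real.log_div hB.ne' (by positivity), Real.log_mul hp.ne' hA.ne',
    Real.log_div (by positivity) (by positivity), Real.log_mul (by positivity) hE.ne',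
    Real.log_mul (by positivity) hB.ne', Real.log_mul hm.ne' hA.ne', Real.log_rpow hε,
    Real.log_pow, logA, logB]
  push_cast
  field_simp
  ring
end

section
/- Let n ≥ 2 be a natural number and let p, K be real numbers with 1 < p < 2 and K > 0. Define Ã = 2p(p−1)^(p−1)/(n−1), and for ε > 0 define B̃(ε) = (2(p−1)/p)·(p(n−1)K²)^(p/(2(p−1)))·ε^(−1) and D̃(ε) = ((2−p)/(n−1))·ε^(2(p−1)/(2−p)). If λ is a real number such that −2·Ã·B̃(ε)·λ + B̃(ε)² + 4D̃(ε) ≥ 0 for every ε > 0, then λ ≤ ((n−1)K/p)^p. -/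
/-- With `c = 2(p-1)/p * (p m K²)^(p/(2(p-1)))`, the minimiser `ε = (c² m/(4p))^((2-p)/2)` satisfies
`Ã p ε (m K / p)^p = c`. -/
lemma mul_minimiser_mul_bound_eq {p m K c : ℝ} (hp : 1 < p) (hm : 0 < m) (hK : 0 < K)
    (hc : c = 2 * (p - 1) / p * (p * m * K ^ 2) ^ (p / (2 * (p - 1)))) :
    2 * p * (p - 1) ^ (p - 1) / m * p * (c ^ 2 * m / (4 * p)) ^ ((2 - p) / 2) *
      (m * K / p) ^ p = c := by
  have hq : 0 < p - 1 := by linarith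
  have hp0 : 0 < p := by linarith
  have hc0 : 0 < c := by rw [hc]; positivity
  have hlc : Real.log c = Real.log 2 + Real.log (p - 1) - Real.log p +
      p / (2 * (p - 1)) * (Real.log p + Real.log m + 2 * Real.log K) := by
    rw [hc, Real.log_mul (by positivity) (by positivity), Real.log_div (by positivity) hp0.ne',
      Real.log_mul two_ne_zero hq.ne', Real.log_rpow (by positivity),
      Real.log_mul (by positivity) (by positivity), Real.log_mul hp0.ne' hm.ne', Real.log_pow]
    push_cast
    ring
  have hl4 : Real.log 4 = 2 * Real.log 2 := by
    rw [show (4 : ℝ) = 2 ^ 2 by norm_num, Real.log_pow]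
    push_cast
    ring
  refine Real.log_injOn_pos (Set.mem_Ioi.2 (by positivity)) (Set.mem_Ioi.2 hc0) ?_
  rw [Real.log_mul (by positivity) (by positivity), Real.log_mul (by positivity) (by positivity),
    Real.log_mul (by positivity) hp0.ne', Real.log_div (by positivity) hm.ne',
    Real.log_mul (by positivity) (by positivity), Real.log_mul two_ne_zero hp0.ne',
    Real.log_rpow hq, Real.log_rpow (by positivity), Real.log_rpow (by positivity),
    Real.log_div (by positivity) (by positivity), Real.log_mul (by positivity) hm.ne',
    Real.log_mul four_ne_zero hp0.ne', Real.log_pow, Real.log_div (by positivity) hp0.ne',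
    Real.log_mul hm.ne' hK.ne', hl4, hlc]
  push_cast
  field_simp
  ring


/-- Analytic core of Theorem 1.2: if `λ` satisfies the linear inequality
`−2ÃB̃(ε)λ + B̃(ε)² + 4D̃(ε) ≥ 0` for every `ε > 0`, then `λ ≤ ((n−1)K/p)^p`. -/
theorem eigenvalue_upper_bound_p_lt_two (n : ℕ) (hn : 2 ≤ n) (p K lam : ℝ)
    (hp1 : 1 < p) (hp2 : p < 2) (hK : 0 < K) :
    let At : ℝ := 2 * p * (p - 1) ^ (p - 1) / ((n : ℝ) - 1)
    let Bt : ℝ → ℝ := fun ε =>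
      2 * (p - 1) / p * (p * ((n : ℝ) - 1) * K ^ 2) ^ (p / (2 * (p - 1))) * ε⁻¹
    let Dt : ℝ → ℝ := fun ε =>
      (2 - p) / ((n : ℝ) - 1) * ε ^ (2 * (p - 1) / (2 - p))
    (∀ ε : ℝ, 0 < ε → -2 * At * Bt ε * lam + Bt ε ^ 2 + 4 * Dt ε ≥ 0) →
      lam ≤ (((n : ℝ) - 1) * K / p) ^ p := by
  intro At Bt Dt h
  obtain ⟨m, hm⟩ : ∃ m : ℝ, m = (n : ℝ) - 1 := ⟨_, rfl⟩
  have hm0 : 0 < m := by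
    have : (2 : ℝ) ≤ n := by exact_mod_cast hn
    linarith
  simp only [At, Bt, Dt, ← hm] at h
  rw [← hm]
  have hq : 0 < p - 1 := by linarith
  have hr : 0 < 2 - p := by linarith
  have hp0 : 0 < p := by linarith
  obtain ⟨c, hc⟩ : ∃ c, c = 2 * (p - 1) / p * (p * m * K ^ 2) ^ (p / (2 * (p - 1))) := ⟨_, rfl⟩
  have hc0 : 0 < c := by rw [hc]; positivity
  have hbound := mul_minimiser_mul_bound_eq hp1 hm0 hK hc
  rw [← hc] at h
  obtain ⟨ε, hε⟩ : ∃ ε, ε = (c ^ 2 * m / (4 * p)) ^ ((2 - p) / 2) := ⟨_, rfl⟩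
  have hε0 : 0 < ε := by rw [hε]; positivity
  have hpow : ε ^ (2 * (p - 1) / (2 - p)) * ε ^ 2 = c ^ 2 * m / (4 * p) := by
    rw [← Real.rpow_natCast ε 2, ← Real.rpow_add hε0, hε, ← Real.rpow_mul (by positivity)]
    convert Real.rpow_one _ using 2
    push_cast
    field_simp
    ring
  rw [← hε] at hbound
  have hA0 : 0 < 2 * p * (p - 1) ^ (p - 1) / m := by positivity
  have hε' := mul_nonneg (h ε hε0) (sq_nonneg ε)
  generalize 2 * p * (p - 1) ^ (p - 1) / m = A at *
  have hscaled : (-2 * A * (c * ε⁻¹) * lam + (c * ε⁻¹) ^ 2 +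
      4 * ((2 - p) / m * ε ^ (2 * (p - 1) / (2 - p)))) * ε ^ 2 =
      2 * c / p * (c - A * p * ε * lam) := by
    calc _ = -2 * A * c * ε * lam + c ^ 2 +
          4 * ((2 - p) / m) * (ε ^ (2 * (p - 1) / (2 - p)) * ε ^ 2) := by
          field_simp
      _ = _ := by
          rw [hpow]
          field_simp
          ring
  rw [hscaled] at hε'
  have hle : A * p * ε * lam ≤ c :=
    sub_nonneg.1 (nonneg_of_mul_nonneg_right hε' (by positivity))
  rw [← hbound] at hle
  exact le_of_mul_le_mul_left hle (by positivity)
end
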